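/- Let S be a stationary subset of E_0, let λ < κ be a regular uncountable cardinal, and let ⟨M_ξ : ξ < λ⟩ be a sequence of conditions in Q(S) such that M_ξ is stronger than M_η whenever η < ξ, with the following property: for every η < λ of cofinality ω, if N is any model coherent with M_η such that there exists some γ ∈ N ∩ M_η with γ ∉ ⋃_{ξ<η} M_ξ, then κ_N > sup_{ξ<η} κ_{M_ξ}. Then M = ⋃_{ξ<λ} M_ξ, with π^M = ⋃_{ξ<λ} π^{M_ξ} and ρ^M = ⋃_{ξ<λ} ρ^{M_ξ}, is a condition in Q(S). -/

import Mathlib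

open Cardinal Set

namespace PKL

/-- The order type of a set of ordinals (as an ordinal one universe up). -/
noncomputable def otp (s : Set Ordinal.{0}) : Ordinal.{1} :=
  Ordinal.type ((· < ·) : s → s → Prop)

/-- `𝒫_κ A` : all subsets of `A` of cardinality `< κ`. -/
def PSet (κ : Cardinal.{0}) (A : Set Ordinal.{0}) : Set (Set Ordinal.{0}) :=
  {x | x ⊆ A ∧ #x < Cardinal.lift.{1} κ}

/-- `C` is closed unbounded in `𝒫_κ A`: it is `⊆`-cofinal and closed under
unions of `⊆`-increasing chains of length `< κ`. -/
def IsClub (κ : Cardinal.{0}) (A : Set Ordinal.{0}) (C : Set (Set Ordinal.{0})) : Prop :=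
  C ⊆ PSet κ A ∧
  (∀ x ∈ PSet κ A, ∃ y ∈ C, x ⊆ y) ∧
  (∀ δ : Ordinal.{0}, 0 < δ → δ < κ.ord → ∀ f : Ordinal.{0} → Set Ordinal.{0},
    (∀ α β, α ≤ β → β < δ → f α ⊆ f β) →
    (∀ α < δ, f α ∈ C) → (⋃ α ∈ Set.Iio δ, f α) ∈ C)

/-- `S` is stationary in `𝒫_κ A`: it meets every closed unbounded set. -/
def IsStationary (κ : Cardinal.{0}) (A : Set Ordinal.{0}) (S : Set (Set Ordinal.{0})) : Prop :=
  ∀ C, IsClub κ A C → (S ∩ C).Nonempty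

/-- `κ⁺` as an ordinal: the initial ordinal of the successor cardinal of `κ`. -/
noncomputable def succOrd (κ : Cardinal.{0}) : Ordinal.{0} := (Order.succ κ).ord

/-- The ordinal `δ` is a limit cardinal. -/
def IsLimitCardOrd (δ : Ordinal.{0}) : Prop :=
  δ.card.ord = δ ∧ ℵ₀ ≤ δ.card ∧ ∀ c < δ.card, Order.succ c < δ.card

/-- The ordinal `δ` is an inaccessible cardinal. -/
def IsInaccessibleOrd (δ : Ordinal.{0}) : Prop :=
  δ.card.ord = δ ∧ δ.card.IsInaccessible

/-- `E₀ = {x ∈ 𝒫_κ κ⁺ : κ_x is a limit cardinal and cf κ_x = cf λ_x}`. -/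
noncomputable def E0 (κ : Cardinal.{0}) : Set (Set Ordinal.{0}) :=
  {x | x ∈ PSet κ (Iio (succOrd κ)) ∧ ∃ δ : Ordinal.{0},
    x ∩ Iio κ.ord = Iio δ ∧ IsLimitCardOrd δ ∧ Cardinal.lift.{1} δ.cof = (otp x).cof}

/-- `E₁ = {x ∈ 𝒫_κ κ⁺ : κ_x is inaccessible and λ_x = κ_x⁺}`. -/
noncomputable def E1 (κ : Cardinal.{0}) : Set (Set Ordinal.{0}) :=
  {x | x ∈ PSet κ (Iio (succOrd κ)) ∧ ∃ δ : Ordinal.{0},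
    x ∩ Iio κ.ord = Iio δ ∧ IsInaccessibleOrd δ ∧ otp x = Ordinal.lift.{1} (succOrd δ.card)}

/-- A model `(M, π, ρ)`: `M ∈ 𝒫_κ κ⁺`, `M ∩ κ` is the ordinal `κM`, the order
type of `M` is at most `|κM|⁺`; for `α ∈ M \ κ`, `π_α` maps `M ∩ α` into `M ∩ α`
and maps `κM` onto `M ∩ α`; for `α ∈ M \ κ` and `β < κM`, `β ≤ ρ_α β < κM`.
(`π` and `ρ` are coded as total functions; only their values on the domains
described above are meaningful.) -/
structure OModel (κ : Cardinal.{0}) where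
  M : Set Ordinal.{0}
  κM : Ordinal.{0}
  π : Ordinal.{0} → Ordinal.{0} → Ordinal.{0}
  ρ : Ordinal.{0} → Ordinal.{0} → Ordinal.{0}
  sub : M ⊆ Iio (succOrd κ)
  card_lt : #M < Cardinal.lift.{1} κ
  inter : M ∩ Iio κ.ord = Iio κM
  otp_le : otp M ≤ Ordinal.lift.{1} ((Order.succ κM.card).ord)
  π_mem : ∀ α ∈ M, κ.ord ≤ α → ∀ β ∈ M, β < α → π α β ∈ M ∧ π α β < α
  π_onto : ∀ α ∈ M, κ.ord ≤ α → ∀ γ ∈ M, γ < α → ∃ β < κM, π α β = γ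
  ρ_spec : ∀ α ∈ M, κ.ord ≤ α → ∀ β < κM, β ≤ ρ α β ∧ ρ α β < κM

/-- Two models are coherent: their `π`'s and `ρ`'s agree wherever both are defined. -/
def Coherent {κ : Cardinal.{0}} (A B : OModel κ) : Prop :=
  (∀ α ∈ A.M ∩ B.M, κ.ord ≤ α → ∀ β ∈ A.M ∩ B.M, β < α → A.π α β = B.π α β) ∧
  (∀ α ∈ A.M ∩ B.M, κ.ord ≤ α → ∀ β : Ordinal.{0}, β < A.κM → β < B.κM →
    A.ρ α β = B.ρ α β)

/-- `A` is a submodel of `B`: `A.M ⊆ B.M` and `π^A ⊆ π^B`, `ρ^A ⊆ ρ^B`. -/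
def Submodel {κ : Cardinal.{0}} (A B : OModel κ) : Prop :=
  A.M ⊆ B.M ∧
  (∀ α ∈ A.M, κ.ord ≤ α → ∀ β ∈ A.M, β < α → A.π α β = B.π α β) ∧
  (∀ α ∈ A.M, κ.ord ≤ α → ∀ β < A.κM, A.ρ α β = B.ρ α β)

/-- A condition in `Q(S)` (for `S` a stationary subset of `E₀`),
Definition 3.3 of the paper. -/
structure IsCondition (κ : Cardinal.{0}) (S : Set (Set Ordinal.{0})) (A : OModel κ) :
    Prop where
  /-- `M` is `ω`-closed. -/
  omega_closed : ∀ γ : Ordinal.{0}, γ.cof = ℵ₀ → sSup (A.M ∩ Iio γ) = γ → γ ∈ A.M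
  /-- Clause (ii) of Definition 3.3. -/
  sup_prop : ∀ α ∈ A.M, κ.ord ≤ α → ∀ β < A.κM, ∀ γ : Ordinal.{0}, A.κM ≤ γ → γ < α →
    ∀ f : ℕ → Ordinal.{0}, (∀ n, f n < β) → γ = ⨆ n, A.π α (f n) →
    ∃ ζ < A.ρ α β, γ = A.π α ζ
  /-- Clause (iii): for every submodel `a ∈ E₁`, `S ∩ 𝒫_{κ_a} a` is stationary
  in `𝒫_{κ_a} a`. -/
  reflect : ∀ a : OModel κ, Submodel a A → a.M ∈ E1 κ →
    IsStationary a.κM.card a.M (S ∩ PSet a.κM.card a.M)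

/-- `N` is a stronger condition than `M`. -/
def Stronger {κ : Cardinal.{0}} (N M : OModel κ) : Prop :=
  Submodel M N ∧ #M.M < Cardinal.lift.{1} N.κM.card

theorem otp_le_lift_ord_succ {s : Set Ordinal.{0}} {c : Cardinal.{0}}
    (h : ∀ α ∈ s, #(s ∩ Iio α : Set Ordinal.{0}) ≤ Cardinal.lift.{1} c) :
    otp s ≤ Ordinal.lift.{1} (Order.succ c).ord := by
  by_contra! hlt
  obtain ⟨α, hα⟩ := Ordinal.typein_surj _ hlt
  have hcard := congrArg Ordinal.card hα
  rw [Ordinal.card_typein, ← Ordinal.lift_card, Cardinal.card_ord, Cardinal.lift_succ] at hcard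
  have hinj : #{y : s // y < α} ≤ #(s ∩ Iio α.1 : Set Ordinal.{0}) :=
    Cardinal.mk_le_of_injective
      (f := fun y => (⟨y.1.1, y.1.2, y.2⟩ : (s ∩ Iio α.1 : Set Ordinal.{0})))
      fun x y hxy => Subtype.ext (Subtype.ext (Subtype.mk.inj hxy))
  exact (Order.lt_succ (Cardinal.lift.{1} c)).not_ge (hcard ▸ hinj.trans (h α α.2))

theorem cof_iSup_nat {f : ℕ → Ordinal.{0}} (hf : StrictMono f) : (⨆ n, f n).cof = ℵ₀ := by
  rw [Ordinal.cof_iSup hf, Order.cof_nat]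

theorem exists_lt_forall_le_of_aleph0_lt_cof {ι : Type*} [Countable ι] {o : Ordinal.{0}}
    (ho : ℵ₀ < o.cof) {f : ι → Ordinal.{0}} (hf : ∀ i, f i < o) : ∃ b < o, ∀ i, f i ≤ b := by
  refine ⟨⨆ i, f i, Ordinal.lift_iSup_lt_of_lt_cof ?_ hf, Ordinal.le_iSup f⟩
  rw [← Ordinal.lift_cof]
  exact (Cardinal.lift_le_aleph0.2 Cardinal.mk_le_aleph0).trans_lt (Cardinal.aleph0_lt_lift.2 ho)

/-- A set with supremum `γ` of countable cofinality has a countable subset with supremum `γ`. -/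
theorem exists_seq_of_cof_eq_aleph0 {γ : Ordinal.{0}} (hγ : γ.cof = ℵ₀) {A : Set Ordinal.{0}}
    (hA : sSup (A ∩ Iio γ) = γ) :
    ∃ (ι : Type 1) (_ : Countable ι) (f : ι → Ordinal.{0}), (∀ i, f i ∈ A ∩ Iio γ) ∧
      ∀ b < γ, ∃ i, b < f i := by
  obtain ⟨s, hs, hcard⟩ := Order.exists_cof_eq (Iio γ)
  rw [Ordinal.cof_Iio, ← Ordinal.lift_cof, hγ, Cardinal.lift_aleph0] at hcard
  have hne : (A ∩ Iio γ).Nonempty := by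
    by_contra! h
    rw [h] at hA
    simp at hA
    exact Cardinal.aleph0_ne_zero (by rw [← hγ, ← hA, Ordinal.cof_zero])
  have hx : ∀ b : s, ∃ x ∈ A ∩ Iio γ, b.1.1 < x := fun b => exists_lt_of_lt_csSup hne
    (hA.symm ▸ b.1.2)
  choose f hf hlt using hx
  refine ⟨s, Cardinal.mk_le_aleph0_iff.1 hcard.le, f, hf, fun b hb => ?_⟩
  obtain ⟨c, hc, hbc⟩ := hs ⟨b, hb⟩
  exact ⟨⟨c, hc⟩, lt_of_le_of_lt hbc (hlt ⟨c, hc⟩)⟩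

theorem sSup_inter_Iio_eq {A : Set Ordinal.{0}} {γ : Ordinal.{0}}
    (h : ∀ b < γ, ∃ x ∈ A ∩ Iio γ, b < x) : sSup (A ∩ Iio γ) = γ := by
  refine le_antisymm (csSup_le' fun x hx => le_of_lt hx.2) (le_of_forall_lt fun b hb => ?_)
  obtain ⟨x, hx, hbx⟩ := h b hb
  exact hbx.trans_le (le_csSup ⟨γ, fun y hy => le_of_lt hy.2⟩ hx)

namespace OModel

variable {κ : Cardinal.{0}} {A B : OModel κ}

theorem lt_κM_iff {β : Ordinal.{0}} : β < A.κM ↔ β ∈ A.M ∧ β < κ.ord := by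
  rw [← Set.mem_Iio, ← A.inter]
  rfl

theorem mem_of_lt_κM {β : Ordinal.{0}} (h : β < A.κM) : β ∈ A.M := (lt_κM_iff.1 h).1

theorem lt_ord_of_lt_κM {β : Ordinal.{0}} (h : β < A.κM) : β < κ.ord := (lt_κM_iff.1 h).2

theorem κM_le_ord (A : OModel κ) : A.κM ≤ κ.ord := le_of_forall_lt fun _ => lt_ord_of_lt_κM

theorem κM_le_of_subset (h : A.M ⊆ B.M) : A.κM ≤ B.κM :=
  le_of_forall_lt fun _ hb => lt_κM_iff.2 ⟨h (mem_of_lt_κM hb), lt_ord_of_lt_κM hb⟩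

end OModel

namespace Submodel

variable {κ : Cardinal.{0}} {A B C : OModel κ}

theorem refl (A : OModel κ) : Submodel A A :=
  ⟨subset_rfl, fun _ _ _ _ _ _ => rfl, fun _ _ _ _ _ => rfl⟩

theorem κM_le (h : Submodel A B) : A.κM ≤ B.κM := OModel.κM_le_of_subset h.1

theorem of_subset (hA : Submodel A C) (hB : Submodel B C) (h : A.M ⊆ B.M) : Submodel A B :=
  ⟨h, fun α hα hκ β hβ hlt =>
      (hA.2.1 α hα hκ β hβ hlt).trans (hB.2.1 α (h hα) hκ β (h hβ) hlt).symm,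
    fun α hα hκ β hβ => (hA.2.2 α hα hκ β hβ).trans
      (hB.2.2 α (h hα) hκ β (hβ.trans_le (OModel.κM_le_of_subset h))).symm⟩

theorem coherent (hA : Submodel A C) (hB : Submodel B C) : Coherent A B :=
  ⟨fun α hα hκ β hβ hlt =>
      (hA.2.1 α hα.1 hκ β hβ.1 hlt).trans (hB.2.1 α hα.2 hκ β hβ.2 hlt).symm,
    fun α hα hκ β hβ hβ' => (hA.2.2 α hα.1 hκ β hβ).trans (hB.2.2 α hα.2 hκ β hβ').symm⟩

/-- The trace of a submodel `A` on a submodel `B` with `κ_A ≤ κ_B` is an initial segment of `A`. -/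
theorem mem_of_lt (hA : Submodel A C) (hB : Submodel B C) (hle : A.κM ≤ B.κM)
    {x y : Ordinal.{0}} (hx : x ∈ A.M) (hyA : y ∈ A.M) (hyB : y ∈ B.M) (hxy : x < y) :
    x ∈ B.M := by
  rcases lt_or_ge y κ.ord with hy | hy
  · exact OModel.mem_of_lt_κM (hxy.trans (OModel.lt_κM_iff.2 ⟨hyB, hy⟩))
  · obtain ⟨β, hβ, rfl⟩ := A.π_onto y hyA hy x hx hxy
    have hβy : β < y := (OModel.lt_ord_of_lt_κM hβ).trans_le hy
    have hβB := OModel.mem_of_lt_κM (hβ.trans_le hle)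
    rw [hA.2.1 y hyA hy β (OModel.mem_of_lt_κM hβ) hβy, ← hB.2.1 y hyB hy β hβB hβy]
    exact (B.π_mem y hyB hy β hβB hβy).1

end Submodel

/-- `M` is the union of the increasing chain of models `Ms ξ`, `ξ < o`. -/
structure IsChainUnion {κ : Cardinal.{0}} (o : Ordinal.{0}) (Ms : Ordinal.{0} → OModel κ)
    (M : OModel κ) : Prop where
  mem_iff : ∀ x, x ∈ M.M ↔ ∃ ξ < o, x ∈ (Ms ξ).M
  mono : ∀ η ξ, η ≤ ξ → ξ < o → Submodel (Ms η) (Ms ξ)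
  submodel : ∀ ξ < o, Submodel (Ms ξ) M

namespace IsChainUnion

variable {κ : Cardinal.{0}} {o : Ordinal.{0}} {Ms : Ordinal.{0} → OModel κ} {M : OModel κ}

theorem exists_lt_κM (h : IsChainUnion o Ms M) {β : Ordinal.{0}} (hβ : β < M.κM) :
    ∃ ξ < o, β < (Ms ξ).κM := by
  obtain ⟨hβM, hβκ⟩ := OModel.lt_κM_iff.1 hβ
  obtain ⟨ξ, hξ, hβξ⟩ := (h.mem_iff β).1 hβM
  exact ⟨ξ, hξ, OModel.lt_κM_iff.2 ⟨hβξ, hβκ⟩⟩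

theorem omega_closed (h : IsChainUnion o Ms M) (ho : ℵ₀ < o.cof)
    {S : Set (Set Ordinal.{0})} (hcond : ∀ ξ < o, IsCondition κ S (Ms ξ)) {γ : Ordinal.{0}}
    (hγ : γ.cof = ℵ₀) (hM : sSup (M.M ∩ Iio γ) = γ) : γ ∈ M.M := by
  obtain ⟨ι, _, f, hf, hcof⟩ := exists_seq_of_cof_eq_aleph0 hγ hM
  choose g hgo hg using fun i => (h.mem_iff _).1 (hf i).1
  obtain ⟨ξ, hξ, hgξ⟩ := exists_lt_forall_le_of_aleph0_lt_cof ho hgo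
  refine (h.submodel ξ hξ).1 ((hcond ξ hξ).omega_closed γ hγ (sSup_inter_Iio_eq fun b hb => ?_))
  obtain ⟨i, hi⟩ := hcof b hb
  exact ⟨f i, ⟨(h.mono _ _ (hgξ i) hξ).1 (hg i), (hf i).2⟩, hi⟩

theorem sup_prop (h : IsChainUnion o Ms M)
    {S : Set (Set Ordinal.{0})} (hcond : ∀ ξ < o, IsCondition κ S (Ms ξ)) {α β γ : Ordinal.{0}}
    (hα : α ∈ M.M) (hακ : κ.ord ≤ α) (hβ : β < M.κM) (hγ : M.κM ≤ γ) (hγα : γ < α)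
    {f : ℕ → Ordinal.{0}} (hf : ∀ n, f n < β) (hγf : γ = ⨆ n, M.π α (f n)) :
    ∃ ζ < M.ρ α β, γ = M.π α ζ := by
  obtain ⟨ξ₁, hξ₁, hαξ⟩ := (h.mem_iff α).1 hα
  obtain ⟨ξ₂, hξ₂, hβξ⟩ := h.exists_lt_κM hβ
  have hξ : max ξ₁ ξ₂ < o := max_lt hξ₁ hξ₂
  have hsub := h.submodel _ hξ
  replace hαξ := (h.mono _ _ (le_max_left ξ₁ ξ₂) hξ).1 hαξ
  replace hβξ := hβξ.trans_le (h.mono _ _ (le_max_right ξ₁ ξ₂) hξ).κM_le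
  have hπ : ∀ ζ < (Ms (max ξ₁ ξ₂)).κM, (Ms (max ξ₁ ξ₂)).π α ζ = M.π α ζ := fun ζ hζ =>
    hsub.2.1 α hαξ hακ ζ (OModel.mem_of_lt_κM hζ) ((OModel.lt_ord_of_lt_κM hζ).trans_le hακ)
  obtain ⟨ζ, hζ, hγζ⟩ := (hcond _ hξ).sup_prop α hαξ hακ β hβξ γ (hsub.κM_le.trans hγ) hγα f hf
    (hγf.trans (iSup_congr fun n => (hπ _ ((hf n).trans hβξ)).symm))
  refine ⟨ζ, hsub.2.2 α hαξ hακ β hβξ ▸ hζ, ?_⟩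
  rw [hγζ, hπ ζ (hζ.trans ((Ms _).ρ_spec α hαξ hακ β hβξ).2)]

/-- A submodel `a` of the union with `cf κ_a > ω` and `κ_a < κ_M` is contained in a member of the
chain. -/
theorem exists_subset (h : IsChainUnion o Ms M) (ho : ℵ₀ < o.cof)
    {S : Set (Set Ordinal.{0})} (hcond : ∀ ξ < o, IsCondition κ S (Ms ξ))
    (hprop : ∀ η < o, η.cof = ℵ₀ →
      ∀ N : OModel κ, Coherent N (Ms η) →
        (∃ γ, γ ∈ N.M ∩ (Ms η).M ∧ γ ∉ ⋃ ξ ∈ Set.Iio η, (Ms ξ).M) →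
        (⨆ ξ : Set.Iio η, (Ms ξ).κM) < N.κM)
    {a : OModel κ} (ha : Submodel a M) (hcof : ℵ₀ < a.κM.cof) (hlt : a.κM < M.κM) :
    ∃ ξ < o, a.M ⊆ (Ms ξ).M := by
  by_contra! hno
  obtain ⟨ξ₀, hξ₀, hκ₀⟩ := h.exists_lt_κM hlt
  have hκ : ∀ ξ, ξ₀ ≤ ξ → ξ < o → a.κM ≤ (Ms ξ).κM := fun ξ hle hξ =>
    hκ₀.le.trans (h.mono _ _ hle hξ).κM_le
  have hinit : ∀ ξ, ξ₀ ≤ ξ → ξ < o → ∀ x ∈ a.M, x ∉ (Ms ξ).M → ∀ y ∈ a.M, y ∈ (Ms ξ).M →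
      y < x := fun ξ hle hξ x hx hxξ y hy hyξ => by
    by_contra! hxy
    rcases hxy.eq_or_lt with rfl | hxy
    · exact hxξ hyξ
    · exact hxξ (ha.mem_of_lt (h.submodel ξ hξ) (hκ ξ hle hξ) hx hy hyξ hxy)
  have hstep : ∀ ξ : Ico ξ₀ o, ∃ ξ' : Ico ξ₀ o, ξ < ξ' ∧
      ∃ x ∈ a.M, x ∉ (Ms ξ).M ∧ x ∈ (Ms ξ').M := fun ξ => by
    obtain ⟨x, hx, hxξ⟩ := Set.not_subset.1 (hno ξ ξ.2.2)
    obtain ⟨ζ, hζ, hxζ⟩ := (h.mem_iff x).1 (ha.1 hx)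
    have hξζ : ξ.1 < ζ := by
      by_contra! hle
      exact hxξ ((h.mono _ _ hle ξ.2.2).1 hxζ)
    exact ⟨⟨ζ, ξ.2.1.trans hξζ.le, hζ⟩, hξζ, x, hx, hxξ, hxζ⟩
  choose g hg x hxa hxn hxg using hstep
  let s : ℕ → Ico ξ₀ o := fun n => g^[n] ⟨ξ₀, le_rfl, hξ₀⟩
  have hs : ∀ n, s (n + 1) = g (s n) := fun n => Function.iterate_succ_apply' g n _
  have hsmono : StrictMono fun n => (s n).1 := strictMono_nat_of_lt_succ fun n => by
    simpa only [hs] using Subtype.coe_lt_coe.2 (hg (s n))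
  have hxmono : StrictMono fun n => x (s n) := strictMono_nat_of_lt_succ fun n =>
    hinit _ (s (n + 1)).2.1 (s (n + 1)).2.2 _ (hxa _) (hxn _) _ (hxa _) (hs n ▸ hxg (s n))
  set η := ⨆ n, (s n).1 with hη
  have hηcof : η.cof = ℵ₀ := cof_iSup_nat hsmono
  have hsη : ∀ n, (s n).1 < η := fun n =>
    (hsmono n.lt_succ_self).trans_le (Ordinal.le_iSup (fun n => (s n).1) _)
  have hηo : η < o := by
    obtain ⟨b, hb, hsb⟩ := exists_lt_forall_le_of_aleph0_lt_cof ho fun n => (s n).2.2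
    exact (Ordinal.iSup_le hsb).trans_lt hb
  have hξ₀η : ξ₀ < η := hsη 0
  have hxη : ∀ n, x (s n) ∈ (Ms η).M := fun n =>
    (h.mono _ _ (hsη (n + 1)).le hηo).1 (hs n ▸ hxg (s n))
  have htrace : ∀ γ ∈ a.M, γ ∈ (Ms η).M → ∃ n, γ ∈ (Ms (s n)).M := fun γ hγa hγη => by
    by_contra! hγ
    refine (hprop η hηo hηcof a (ha.coherent (h.submodel η hηo)) ⟨γ, ⟨hγa, hγη⟩, ?_⟩).not_ge
      (hκ₀.le.trans (Ordinal.le_iSup (fun ξ : Iio η => (Ms ξ).κM) ⟨ξ₀, hξ₀η⟩))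
    simp only [Set.mem_iUnion, not_exists]
    intro ξ hξ hγξ
    obtain ⟨n, hn⟩ := Ordinal.lt_iSup_iff.1 (show ξ < η from hξ)
    exact hγ n ((h.mono _ _ hn.le (s n).2.2).1 hγξ)
  set δ := ⨆ n, x (s n) with hδ
  have hxδ : ∀ n, x (s n) < δ := fun n =>
    (hxmono n.lt_succ_self).trans_le (Ordinal.le_iSup (fun n => x (s n)) _)
  have hδη : δ ∈ (Ms η).M := (hcond η hηo).omega_closed δ (cof_iSup_nat hxmono)
    (sSup_inter_Iio_eq fun b hb => by
      obtain ⟨n, hn⟩ := Ordinal.lt_iSup_iff.1 hb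
      exact ⟨x (s n), ⟨hxη n, hxδ n⟩, hn⟩)
  obtain ⟨α, hαa, hαη⟩ := Set.not_subset.1 (hno η hηo)
  have hxα : ∀ n, x (s n) < α := fun n =>
    hinit η hξ₀η.le hηo α hαa hαη _ (hxa _) (hxη n)
  have hδα : δ < α := lt_of_le_of_ne (Ordinal.iSup_le fun n => (hxα n).le)
    fun heq => hαη (heq ▸ hδη)
  have hκδ : κ.ord ≤ δ := by
    by_contra! hlt'
    exact hxn (s 0) (OModel.mem_of_lt_κM (lt_of_lt_of_le
      (OModel.lt_κM_iff.2 ⟨hxa (s 0), (hxδ 0).trans hlt'⟩) (hκ _ (s 0).2.1 (s 0).2.2)))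
  have hκα : κ.ord ≤ α := hκδ.trans hδα.le
  have hπ : ∀ ζ < a.κM, a.π α ζ = M.π α ζ := fun ζ hζ =>
    ha.2.1 α hαa hκα ζ (OModel.mem_of_lt_κM hζ) ((OModel.lt_ord_of_lt_κM hζ).trans_le hκα)
  choose b hb hbx using fun n => a.π_onto α hαa hκα _ (hxa (s n)) (hxα n)
  obtain ⟨β, hβ, hbβ⟩ := exists_lt_forall_le_of_aleph0_lt_cof hcof hb
  have hlim : Order.IsSuccLimit a.κM := Ordinal.one_lt_cof_iff.1 (Cardinal.one_lt_aleph0.trans hcof)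
  have hβ' : Order.succ β < a.κM := hlim.succ_lt hβ
  obtain ⟨ζ, hζ, hδζ⟩ := h.sup_prop hcond (ha.1 hαa) hκα (hβ'.trans hlt)
    (M.κM_le_ord.trans hκδ) hδα (fun n => Order.lt_succ_of_le (hbβ n))
    (hδ.trans (iSup_congr fun n => by rw [← hbx n, hπ _ (hb n)]))
  rw [← ha.2.2 α hαa hκα _ hβ'] at hζ
  have hζκ : ζ < a.κM := hζ.trans (a.ρ_spec α hαa hκα _ hβ').2
  have hδa : δ ∈ a.M := by
    rw [hδζ, ← hπ ζ hζκ]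
    exact (a.π_mem α hαa hκα ζ (OModel.mem_of_lt_κM hζκ)
      ((OModel.lt_ord_of_lt_κM hζκ).trans_le hκα)).1
  obtain ⟨n, hn⟩ := htrace δ hδa hδη
  exact (hinit _ (s n).2.1 (s n).2.2 _ (hxa _) (hxn _) δ hδa hn).not_gt (hxδ n)

/-- The union has cardinality at most `κ_M` if the length of the chain is at most `κ_M`. -/
theorem mk_le (h : IsChainUnion o Ms M) (hoκ : o.card ≤ M.κM.card) (hinf : ℵ₀ ≤ M.κM.card)
    (hcard : ∀ ξ < o, #(Ms ξ).M ≤ Cardinal.lift.{1} M.κM.card) :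
    #M.M ≤ Cardinal.lift.{1} M.κM.card := by
  have hM : M.M = ⋃ ξ ∈ Iio o, (Ms ξ).M := by
    ext x
    simp [h.mem_iff]
  have hinf' : ℵ₀ ≤ Cardinal.lift.{1} M.κM.card := Cardinal.aleph0_le_lift.2 hinf
  rw [hM]
  refine (Cardinal.mk_biUnion_le _ _).trans ?_
  rw [Cardinal.mk_Iio_ordinal]
  exact (mul_le_mul' (Cardinal.lift_le.2 hoκ) (ciSup_le' fun ξ : Iio o => hcard ξ.1 ξ.2)).trans
    (Cardinal.mul_eq_self hinf').le

end IsChainUnion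

/-- The union of a chain of models whose length has cardinality `< κ`. -/
theorem exists_isChainUnion {κ : Cardinal.{0}} (hκ : κ.IsRegular) {o : Ordinal.{0}}
    (ho : o.card < κ) {Ms : Ordinal.{0} → OModel κ}
    (hmono : ∀ η ξ, η ≤ ξ → ξ < o → Submodel (Ms η) (Ms ξ)) :
    ∃ M : OModel κ, IsChainUnion o Ms M := by
  classical
  let U : Set Ordinal.{0} := ⋃ ξ ∈ Iio o, (Ms ξ).M
  have hU : ∀ x, x ∈ U ↔ ∃ ξ < o, x ∈ (Ms ξ).M := fun x => by simp [U]
  let k : Ordinal.{0} := ⨆ ξ : Iio o, (Ms ξ).κM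
  have hk : ∀ β, β < k ↔ ∃ ξ < o, β < (Ms ξ).κM := fun β => by
    simp only [k, Ordinal.lt_iSup_iff, Subtype.exists, Set.mem_Iio, exists_prop]
  have hcommon : ∀ α ∈ U, ∀ β ∈ U, ∃ ξ < o, α ∈ (Ms ξ).M ∧ β ∈ (Ms ξ).M := by
    intro α hα β hβ
    obtain ⟨ξ, hξ, hαξ⟩ := (hU α).1 hα
    obtain ⟨ζ, hζ, hβζ⟩ := (hU β).1 hβ
    exact ⟨max ξ ζ, max_lt hξ hζ, (hmono _ _ (le_max_left _ _) (max_lt hξ hζ)).1 hαξ,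
      (hmono _ _ (le_max_right _ _) (max_lt hξ hζ)).1 hβζ⟩
  let p : Ordinal.{0} → Ordinal.{0} → Ordinal.{0} := fun α β =>
    if h : ∃ ξ < o, α ∈ (Ms ξ).M ∧ β ∈ (Ms ξ).M then (Ms h.choose).π α β else 0
  let r : Ordinal.{0} → Ordinal.{0} → Ordinal.{0} := fun α β =>
    if h : ∃ ξ < o, α ∈ (Ms ξ).M ∧ β < (Ms ξ).κM then (Ms h.choose).ρ α β else 0
  have hcoh : ∀ ξ < o, ∀ ζ < o, Coherent (Ms ξ) (Ms ζ) := fun ξ hξ ζ hζ =>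
    (hmono _ _ (le_max_left ξ ζ) (max_lt hξ hζ)).coherent
      (hmono _ _ (le_max_right ξ ζ) (max_lt hξ hζ))
  have hp : ∀ ξ < o, ∀ α ∈ (Ms ξ).M, κ.ord ≤ α → ∀ β ∈ (Ms ξ).M, β < α →
      (Ms ξ).π α β = p α β := by
    intro ξ hξ α hα hακ β hβ hβα
    have hex : ∃ ξ < o, α ∈ (Ms ξ).M ∧ β ∈ (Ms ξ).M := ⟨ξ, hξ, hα, hβ⟩
    simp only [p, dif_pos hex]
    obtain ⟨h₁, h₂, h₃⟩ := hex.choose_spec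
    exact (hcoh ξ hξ _ h₁).1 α ⟨hα, h₂⟩ hακ β ⟨hβ, h₃⟩ hβα
  have hr : ∀ ξ < o, ∀ α ∈ (Ms ξ).M, κ.ord ≤ α → ∀ β < (Ms ξ).κM,
      (Ms ξ).ρ α β = r α β := by
    intro ξ hξ α hα hακ β hβ
    have hex : ∃ ξ < o, α ∈ (Ms ξ).M ∧ β < (Ms ξ).κM := ⟨ξ, hξ, hα, hβ⟩
    simp only [r, dif_pos hex]
    obtain ⟨h₁, h₂, h₃⟩ := hex.choose_spec
    exact (hcoh ξ hξ _ h₁).2 α ⟨hα, h₂⟩ hακ β hβ h₃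
  have honto : ∀ α ∈ U, κ.ord ≤ α → ∀ γ ∈ U, γ < α → ∃ β < k, p α β = γ := by
    intro α hα hακ γ hγ hγα
    obtain ⟨ξ, hξ, hαξ, hγξ⟩ := hcommon α hα γ hγ
    obtain ⟨β, hβ, hβγ⟩ := (Ms ξ).π_onto α hαξ hακ γ hγξ hγα
    refine ⟨β, (hk β).2 ⟨ξ, hξ, hβ⟩, ?_⟩
    rw [← hp ξ hξ α hαξ hακ β (OModel.mem_of_lt_κM hβ)
      ((OModel.lt_ord_of_lt_κM hβ).trans_le hακ), hβγ]
  have hinter : U ∩ Iio κ.ord = Iio k := by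
    ext x
    simp only [Set.mem_inter_iff, hU, Set.mem_Iio, hk, OModel.lt_κM_iff]
    grind
  have hseg : ∀ α ∈ U, #(U ∩ Iio α : Set Ordinal.{0}) ≤ Cardinal.lift.{1} k.card := by
    intro α hα
    rw [← Cardinal.mk_Iio_ordinal]
    rcases lt_or_ge α κ.ord with hακ | hακ
    · exact Cardinal.mk_le_mk_of_subset fun x hx => hinter ▸ ⟨hx.1, lt_trans hx.2 hακ⟩
    · refine le_trans (Cardinal.mk_le_mk_of_subset fun x hx => ?_)
        (Cardinal.mk_image_le (f := p α) (s := Iio k))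
      obtain ⟨β, hβ, hβx⟩ := honto α hα hακ x hx.1 hx.2
      exact ⟨β, hβ, hβx⟩
  refine ⟨⟨U, k, p, r, ?_, ?_, hinter, otp_le_lift_ord_succ hseg, ?_, honto, ?_⟩, hU, hmono,
    fun ξ hξ => ⟨fun x hx => (hU x).2 ⟨ξ, hξ, hx⟩, hp ξ hξ, hr ξ hξ⟩⟩
  · exact Set.iUnion₂_subset fun ξ _ => (Ms ξ).sub
  · refine (Cardinal.card_biUnion_lt_iff_forall_of_isRegular hκ.lift ?_).2
      fun ξ _ => (Ms ξ).card_lt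
    rw [Cardinal.mk_Iio_ordinal]
    exact Cardinal.lift_lt.2 ho
  · intro α hα hακ β hβ hβα
    obtain ⟨ξ, hξ, hαξ, hβξ⟩ := hcommon α hα β hβ
    rw [← hp ξ hξ α hαξ hακ β hβξ hβα]
    obtain ⟨h₁, h₂⟩ := (Ms ξ).π_mem α hαξ hακ β hβξ hβα
    exact ⟨(hU _).2 ⟨ξ, hξ, h₁⟩, h₂⟩
  · intro α hα hακ β hβ
    obtain ⟨ξ₁, hξ₁, hαξ⟩ := (hU α).1 hα
    obtain ⟨ξ₂, hξ₂, hβξ⟩ := (hk β).1 hβ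
    have hξ : max ξ₁ ξ₂ < o := max_lt hξ₁ hξ₂
    replace hαξ := (hmono _ _ (le_max_left ξ₁ ξ₂) hξ).1 hαξ
    replace hβξ := hβξ.trans_le (hmono _ _ (le_max_right ξ₁ ξ₂) hξ).κM_le
    rw [← hr _ hξ α hαξ hακ β hβξ]
    obtain ⟨h₁, h₂⟩ := (Ms _).ρ_spec α hαξ hακ β hβξ
    exact ⟨h₁, (hk _).2 ⟨_, hξ, h₂⟩⟩

theorem mk_eq_of_mem_E1 {κ : Cardinal.{0}} {a : OModel κ} (ha : a.M ∈ E1 κ) :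
    a.κM.card.ord = a.κM ∧ a.κM.card.IsInaccessible ∧
      #a.M = Cardinal.lift.{1} (Order.succ a.κM.card) := by
  obtain ⟨-, δ, hδ, ⟨hord, hin⟩, hotp⟩ := ha
  obtain rfl : a.κM = δ := Set.Iio_injective (a.inter.symm.trans hδ)
  refine ⟨hord, hin, ?_⟩
  have := congrArg Ordinal.card hotp
  rwa [otp, Ordinal.card_type, succOrd, ← Ordinal.lift_card, Cardinal.card_ord] at this

/-- Lemma 3.7: if `λ < κ` is regular uncountable and `⟨M_ξ : ξ < λ⟩` is a
descending sequence of conditions in `Q(S)` satisfying property (3.8) at every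
`η < λ` of cofinality `ω`, then the union of the `M_ξ` (with the unions of the
`π`'s and `ρ`'s) is a condition in `Q(S)`. -/
theorem stmt3 (κ : Cardinal.{0}) (hκ : κ.IsInaccessible)
    (S : Set (Set Ordinal.{0})) (hS0 : S ⊆ E0 κ)
    (hSstat : IsStationary κ (Iio (succOrd κ)) S)
    (lam : Cardinal.{0}) (hlamreg : lam.IsRegular) (hlamunc : ℵ₀ < lam)
    (hlamκ : lam < κ)
    (Ms : Ordinal.{0} → OModel κ)
    (hcond : ∀ ξ < lam.ord, IsCondition κ S (Ms ξ))
    (hmono : ∀ η ξ : Ordinal.{0}, η < ξ → ξ < lam.ord → Stronger (Ms ξ) (Ms η))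
    (hprop : ∀ η < lam.ord, η.cof = ℵ₀ →
      ∀ N : OModel κ, Coherent N (Ms η) →
        (∃ γ, γ ∈ N.M ∩ (Ms η).M ∧ γ ∉ ⋃ ξ ∈ Set.Iio η, (Ms ξ).M) →
        (⨆ ξ : Set.Iio η, (Ms ξ).κM) < N.κM) :
    ∃ M : OModel κ, M.M = (⋃ ξ ∈ Set.Iio lam.ord, (Ms ξ).M) ∧
      (∀ ξ < lam.ord, Submodel (Ms ξ) M) ∧ IsCondition κ S M := by
  have hmono' : ∀ η ξ, η ≤ ξ → ξ < lam.ord → Submodel (Ms η) (Ms ξ) := fun η ξ hle hξ => by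
    rcases hle.eq_or_lt with rfl | hlt
    · exact Submodel.refl _
    · exact (hmono η ξ hlt hξ).1
  obtain ⟨M, hM⟩ := exists_isChainUnion hκ.isRegular (by rwa [Cardinal.card_ord]) hmono'
  have hcof : ℵ₀ < lam.ord.cof := by rwa [hlamreg.cof_ord]
  have hlim : Order.IsSuccLimit lam.ord := Cardinal.isSuccLimit_ord hlamreg.aleph0_le
  have hκlt : ∀ η ξ, η < ξ → ξ < lam.ord → (Ms η).κM < (Ms ξ).κM := fun η ξ hlt hξ => by
    refine lt_of_not_ge fun hge => (hmono η ξ hlt hξ).2.not_ge ?_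
    rw [← Cardinal.mk_Iio_ordinal]
    exact Cardinal.mk_le_mk_of_subset fun x hx => OModel.mem_of_lt_κM (lt_of_lt_of_le hx hge)
  have hle : ∀ ξ, ξ < lam.ord → ξ ≤ (Ms ξ).κM := by
    intro ξ
    induction ξ using WellFoundedLT.induction with
    | ind ξ ih =>
      exact fun hξ => le_of_forall_lt fun η hη =>
        (ih η hη (hη.trans hξ)).trans_lt (hκlt η ξ hη hξ)
  have hlamκM : lam ≤ M.κM.card := by
    rw [← Cardinal.ord_le]
    exact le_of_forall_lt fun ξ hξ => ((Order.lt_succ ξ).trans_le (hle _ (hlim.succ_lt hξ))).trans_le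
      (hM.submodel _ (hlim.succ_lt hξ)).κM_le
  have hcard : #M.M ≤ Cardinal.lift.{1} M.κM.card :=
    hM.mk_le (by rwa [Cardinal.card_ord]) (hlamreg.aleph0_le.trans hlamκM) fun ξ hξ =>
      (hmono ξ _ (Order.lt_succ ξ) (hlim.succ_lt hξ)).2.le.trans
        (Cardinal.lift_le.2 (Ordinal.card_le_card (hM.submodel _ (hlim.succ_lt hξ)).κM_le))
  refine ⟨M, by ext x; simp [hM.mem_iff], hM.submodel, ?_, ?_, ?_⟩
  · exact fun γ => hM.omega_closed hcof hcond
  · exact fun α hα hακ β hβ γ hγ hγα f hf => hM.sup_prop hcond hα hακ hβ hγ hγα hf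
  · intro a ha haE
    obtain ⟨hord, hin, hmk⟩ := mk_eq_of_mem_E1 haE
    have hlt : a.κM < M.κM := by
      refine lt_of_le_of_ne ha.κM_le fun heq => ?_
      have := (Cardinal.mk_le_mk_of_subset ha.1).trans hcard
      rw [hmk, heq, Cardinal.lift_le] at this
      exact (Order.lt_succ _).not_ge this
    have hacof : ℵ₀ < a.κM.cof := by
      rw [← hord, hin.isRegular.cof_ord]
      exact hin.aleph0_lt
    obtain ⟨ξ, hξ, hsub⟩ := hM.exists_subset hcof hcond hprop ha hacof hlt
    exact (hcond ξ hξ).reflect a (ha.of_subset (hM.submodel ξ hξ) hsub) haE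

end PKL
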